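/- Let G be a 7-contraction-critical graph with no K7^∨-minor, and let v ∈ V(G) be a vertex with deg(v) = 7. Then there exists a clique L of G of size five such that v ∈ L and L ⊆ N[v]. -/

import Mathlib

open SimpleGraph

/-- `K7vee` is the graph obtained from `K 7` by deleting two edges with a common end. -/
def K7vee : SimpleGraph (Fin 7) :=
  (completeGraph (Fin 7)).deleteEdges {s(0, 1), s(0, 2)}

/-- `K6vee` is the graph obtained from `K 6` by deleting two edges with a common end. -/
def K6vee : SimpleGraph (Fin 6) :=
  (completeGraph (Fin 6)).deleteEdges {s(0, 1), s(0, 2)}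

/-- The complete multipartite graph with four parts of size two. -/
def K2222 : SimpleGraph (Fin 4 × Fin 2) :=
  SimpleGraph.comap Prod.fst (completeGraph (Fin 4))

/-- `H` is a minor of `G`: there is a model of `H` in `G`, i.e. a family of pairwise disjoint
nonempty connected branch sets, one for each vertex of `H`, with edges of `G` between branch
sets corresponding to adjacent vertices of `H`. -/
def IsMinor {W V : Type} (H : SimpleGraph W) (G : SimpleGraph V) : Prop :=
  ∃ bag : W → Set V,
    (∀ w, (G.induce (bag w)).Connected) ∧
    (∀ w w', w ≠ w' → Disjoint (bag w) (bag w')) ∧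
    (∀ w w', H.Adj w w' → ∃ u ∈ bag w, ∃ v ∈ bag w', G.Adj u v)

/-- A graph is `k`-connected if it has more than `k` vertices and stays connected after
removing any set of fewer than `k` vertices. -/
def IsKConnected {V : Type} [Fintype V] (k : ℕ) (G : SimpleGraph V) : Prop :=
  k < Fintype.card V ∧ ∀ S : Set V, S.ncard < k → (G.induce (Sᶜ : Set V)).Connected

/-- A separation of `G`: `A ∪ B = V(G)` and no edge joins `A - B` to `B - A`. -/
def IsSeparation {V : Type} (G : SimpleGraph V) (A B : Set V) : Prop :=
  A ∪ B = Set.univ ∧ ∀ ⦃u v : V⦄, G.Adj u v → ¬(u ∈ A \ B ∧ v ∈ B \ A)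

/-- `(G, Z)` is internally `k`-connected: every separation `(A,B)` of `G` with `Z ⊆ A`
and `B - A ≠ ∅` has order at least `k`. -/
def InternallyConnected {V : Type} (G : SimpleGraph V) (Z : Set V) (k : ℕ) : Prop :=
  ∀ A B : Set V, IsSeparation G A B → Z ⊆ A → (B \ A).Nonempty →
    k ≤ (A ∩ B).ncard

/-- A `Z`-rooted `K₄`-model in `G`. -/
def HasRootedK4Model {V : Type} (G : SimpleGraph V) (Z : Set V) : Prop :=
  ∃ B : Fin 4 → Set V,
    (∀ i, (G.induce (B i)).Connected) ∧
    (∀ i j, i ≠ j → Disjoint (B i) (B j)) ∧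
    (∀ i, ∃! z : V, z ∈ Z ∧ z ∈ B i) ∧
    (∀ z ∈ Z, ∃ i, z ∈ B i) ∧
    (∀ i j, i ≠ j → ∃ u ∈ B i, ∃ v ∈ B j, G.Adj u v)

/-- A `Z`-rooted `K*₄,₂`-model in `G`. -/
def HasRootedK42starModel {V : Type} (G : SimpleGraph V) (Z : Set V) : Prop :=
  ∃ (B : Fin 4 → Set V) (C : Fin 2 → Set V),
    (∀ i, (G.induce (B i)).Connected) ∧
    (∀ j, (G.induce (C j)).Connected) ∧
    (∀ i j, i ≠ j → Disjoint (B i) (B j)) ∧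
    (∀ i j, i ≠ j → Disjoint (C i) (C j)) ∧
    (∀ i j, Disjoint (B i) (C j)) ∧
    (∀ i, ∃! z : V, z ∈ Z ∧ z ∈ B i) ∧
    (∀ z ∈ Z, ∃ i, z ∈ B i) ∧
    (∀ i j, ∃ u ∈ B i, ∃ v ∈ C j, G.Adj u v) ∧
    (∃ u ∈ C 0, ∃ v ∈ C 1, G.Adj u v)

/-- An enemy: a `4`-connected graph with `|E(G)| ≥ 4|V(G)| - 8`, with no `K7vee`-minor,
not isomorphic to `K_{2,2,2,2}`. -/
def Enemy {V : Type} [Fintype V] (G : SimpleGraph V) : Prop :=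
  IsKConnected 4 G ∧
    4 * (Fintype.card V : ℤ) - 8 ≤ (G.edgeSet.ncard : ℤ) ∧
    ¬ IsMinor K7vee G ∧
    IsEmpty (G ≃g K2222)

/-- A minor-minimal enemy: an enemy, no minor of which, other than itself, is an enemy. -/
def MinorMinimalEnemy {V : Type} [Fintype V] (G : SimpleGraph V) : Prop :=
  Enemy G ∧ ∀ (W : Type) [Fintype W] (H : SimpleGraph W),
    IsMinor H G → Enemy H → Nonempty (H ≃g G)

/-- The simple graph obtained from `G` by contracting the edge `uv`
(`v` is merged into `u`). -/
def contractEdge {V : Type} (G : SimpleGraph V) (u v : V) :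
    SimpleGraph {x : V // x ≠ v} :=
  SimpleGraph.fromRel (fun x y => G.Adj ↑x ↑y ∨ ((x : V) = u ∧ G.Adj v ↑y))

/-- A graph is `7`-contraction-critical if its chromatic number is `7` and
every minor of it, other than itself, has chromatic number less than `7`. -/
def ContractionCritical7 {V : Type} [Fintype V] (G : SimpleGraph V) : Prop :=
  G.chromaticNumber = 7 ∧
    ∀ (W : Type) [Fintype W] (H : SimpleGraph W),
      IsMinor H G → IsEmpty (H ≃g G) → H.chromaticNumber < 7


namespace SimpleGraph

/-- `K` (thought of as a non-adjacency relation) looks favourable along the labelling `g`: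
if the non-adjacent pair `g 0`, `g 1` is complemented by the five vertices `g 2, …, g 6`,
made into a path, then contracting `g 1` into `g 2` turns these five into a clique with three
vertices adjacent to `g 0`. -/
def Favourable {α : Type*} (K : SimpleGraph α) (g : Fin 7 → α) : Prop :=
  K.Adj (g 0) (g 1) ∧ ¬ K.Adj (g 1) (g 2) ∧
    ¬ K.Adj (g 0) (g 2) ∧ ¬ K.Adj (g 0) (g 3) ∧ ¬ K.Adj (g 0) (g 5) ∧
    ¬ K.Adj (g 3) (g 5) ∧ ¬ K.Adj (g 3) (g 6) ∧ ¬ K.Adj (g 4) (g 6) ∧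
    (¬ K.Adj (g 2) (g 4) ∨ ¬ K.Adj (g 1) (g 4)) ∧
    (¬ K.Adj (g 2) (g 5) ∨ ¬ K.Adj (g 1) (g 5)) ∧
    (¬ K.Adj (g 2) (g 6) ∨ ¬ K.Adj (g 1) (g 6))

section Favourable

variable {α : Type*} {K : SimpleGraph α}

/-- The pairs of a seven-element set of labels, in the notation of `Favourable`. -/
def favourableBool (m : Fin 7 → Fin 7 → Bool) (s : Fin 7 → Fin 7) : Bool :=
  let b i j := m (s i) (s j) || m (s j) (s i)
  b 0 1 && !b 1 2 && !b 0 2 && !b 0 3 && !b 0 5 && !b 3 5 && !b 3 6 && !b 4 6 &&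
    !(b 2 4 && b 1 4) && !(b 2 5 && b 1 5) && !(b 2 6 && b 1 6)

lemma favourable_of_favourableBool {g : Fin 7 → α} {m : Fin 7 → Fin 7 → Bool}
    {s : Fin 7 → Fin 7} (h : ∀ i j, i < j → (m i j = true ↔ K.Adj (g i) (g j)))
    (hm : ∀ i j, j ≤ i → m i j = false)
    (hs : favourableBool m s = true) : K.Favourable (g ∘ s) := by
  have key : ∀ i j, (m i j || m j i) = true ↔ K.Adj (g i) (g j) := by
    intro i j
    rcases lt_trichotomy i j with hij | rfl | hij
    · simp [h i j hij, hm j i hij.le]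
    · simp [hm i i le_rfl]
    · simp [h j i hij, hm i j hij.le, K.adj_comm]
  have key' : ∀ i j, (m i j || m j i) = false ↔ ¬ K.Adj (g i) (g j) := by
    intro i j
    rw [← key]
    simp
  simp only [favourableBool, Bool.and_eq_true, Bool.not_eq_true', Bool.and_eq_false_iff, key,
    key'] at hs
  simp only [Favourable, Function.comp_apply]
  tauto

/-- A five-cycle with two further vertices, as a matrix. -/
def fiveMatrix (x y : Fin 5 → Bool) (e : Bool) : Fin 7 → Fin 7 → Bool :=
  ![![false, true, false, false, true, x 0, y 0],
    ![false, false, true, false, false, x 1, y 1],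
    ![false, false, false, true, false, x 2, y 2],
    ![false, false, false, false, true, x 3, y 3],
    ![false, false, false, false, false, x 4, y 4],
    ![false, false, false, false, false, false, e],
    ![false, false, false, false, false, false, false]]

lemma exists_favourableBool_five : ∀ (x y : Fin 5 → Bool) (e : Bool),
    (∀ i, (x i && x (i + 1)) = false) → (∀ i, (y i && y (i + 1)) = false) →
    (∀ i, (e && x i && y i) = false) →
    (∀ i, (e || x i || x (i + 2) || y i || y (i + 2)) = true) →
    ∃ s ∈ ([![0, 1, 3, 2, 6, 5, 4], ![0, 1, 3, 2, 5, 6, 4], ![3, 2, 0, 1, 5, 6, 4],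
      ![3, 2, 0, 1, 6, 5, 4], ![1, 0, 3, 4, 2, 5, 6], ![1, 0, 3, 4, 2, 6, 5]] :
        List (Fin 7 → Fin 7)), favourableBool (fiveMatrix x y e) s = true := by
  decide +kernel

/-- A seven-cycle with chords between vertices at distance three, as a matrix. -/
def sevenMatrix (x : Fin 7 → Bool) : Fin 7 → Fin 7 → Bool :=
  ![![false, true, false, x 0, x 4, false, true],
    ![false, false, true, false, x 1, x 5, false],
    ![false, false, false, true, false, x 2, x 6],
    ![false, false, false, false, true, false, x 3],
    ![false, false, false, false, false, true, false],
    ![false, false, false, false, false, false, true],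
    ![false, false, false, false, false, false, false]]

lemma exists_favourableBool_seven : ∀ x : Fin 7 → Bool,
    (∀ i, (x i && x (i + 4)) = false) →
    ∃ s ∈ ([![0, 1, 3, 2, 6, 5, 4], ![1, 0, 5, 6, 2, 3, 4], ![3, 2, 0, 1, 4, 5, 6],
      ![0, 1, 4, 5, 6, 2, 3]] : List (Fin 7 → Fin 7)),
      favourableBool (sevenMatrix x) s = true := by
  decide +kernel

lemma exists_favourable_of_five (htri : ∀ a b c, K.Adj a b → K.Adj b c → ¬ K.Adj a c)
    (hind : ∀ f : Fin 4 → α, f.Injective → ∃ i j, K.Adj (f i) (f j))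
    {g : Fin 7 → α} (hg : g.Injective)
    (h : K.Adj (g 0) (g 1) ∧ K.Adj (g 1) (g 2) ∧ K.Adj (g 2) (g 3) ∧ K.Adj (g 3) (g 4) ∧
      K.Adj (g 4) (g 0)) :
    ∃ g : Fin 7 → α, g.Injective ∧ K.Favourable g := by
  classical
  obtain ⟨h0, h1, h2, h3, h4⟩ := h
  have hcyc : ∀ i : Fin 5, K.Adj (g (i.castLE (by simp))) (g ((i + 1).castLE (by simp))) := by
    intro i; fin_cases i <;> assumption
  let x : Fin 5 → Bool := fun i => decide (K.Adj (g (i.castLE (by simp))) (g 5))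
  let y : Fin 5 → Bool := fun i => decide (K.Adj (g (i.castLE (by simp))) (g 6))
  let e : Bool := decide (K.Adj (g 5) (g 6))
  have n02 := htri _ _ _ h0 h1
  have n13 := htri _ _ _ h1 h2
  have n24 := htri _ _ _ h2 h3
  have n30 := htri _ _ _ h3 h4
  have n41 := htri _ _ _ h4 h0
  obtain ⟨s, hs, hfav⟩ := exists_favourableBool_five x y e
    (fun i => by
      have := htri _ _ (g 5) (hcyc i)
      simp only [x, Bool.and_eq_false_iff, decide_eq_false_iff_not]
      tauto)
    (fun i => by
      have := htri _ _ (g 6) (hcyc i)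
      simp only [y, Bool.and_eq_false_iff, decide_eq_false_iff_not]
      tauto)
    (fun i => by
      have := htri (g (i.castLE (by simp))) (g 5) (g 6)
      simp only [x, y, e, Bool.and_eq_false_iff, decide_eq_false_iff_not]
      tauto)
    (fun i => by
      by_contra hc
      simp only [x, y, e, Bool.or_eq_true, decide_eq_true_eq, not_or] at hc
      obtain ⟨⟨⟨⟨c1, c2⟩, c3⟩, c4⟩, c5⟩ := hc
      obtain ⟨j, k, hjk⟩ := hind
        (g ∘ ![i.castLE (by simp), (i + 2).castLE (by simp), 5, 6])
        (hg.comp (by clear c1 c2 c3 c4 c5; revert i; decide))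
      have n : ¬ K.Adj (g (i.castLE (by simp))) (g ((i + 2).castLE (by simp))) :=
        htri _ _ _ (hcyc i) (by simpa [add_assoc] using hcyc (i + 1))
      fin_cases j <;> fin_cases k <;> simp_all [K.adj_comm])
  have hsinj : s.Injective := by
    clear hfav
    fin_cases hs <;> decide
  refine ⟨g ∘ s, hg.comp hsinj, favourable_of_favourableBool (m := fiveMatrix x y e) ?_ ?_ hfav⟩
  · intro i j hij
    replace h4 := h4.symm
    replace n30 := fun t : K.Adj (g 0) (g 3) => n30 t.symm
    replace n41 := fun t : K.Adj (g 1) (g 4) => n41 t.symm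
    fin_cases i <;> fin_cases j <;> first
      | (exfalso; revert hij; decide)
      | (simp [fiveMatrix, x, y, e]; assumption)
      | simp [fiveMatrix, x, y, e]
  · intro i j hij
    fin_cases i <;> fin_cases j <;> first
      | (exfalso; revert hij; decide)
      | rfl

lemma exists_favourable_of_seven (htri : ∀ a b c, K.Adj a b → K.Adj b c → ¬ K.Adj a c)
    {g : Fin 7 → α} (hg : g.Injective) (h : ∀ i, K.Adj (g i) (g (i + 1))) :
    ∃ g : Fin 7 → α, g.Injective ∧ K.Favourable g := by
  classical
  let x : Fin 7 → Bool := fun i => decide (K.Adj (g i) (g (i + 3)))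
  have hn : ∀ i, ¬ K.Adj (g i) (g (i + 2)) := fun i =>
    htri _ _ _ (h i) (by simpa [add_assoc] using h (i + 1))
  obtain ⟨s, hs, hfav⟩ := exists_favourableBool_seven x
    (fun i => by
      have := htri (g i) (g (i + 3)) (g (i + 4))
      have h1 : K.Adj (g (i + 3)) (g (i + 4)) := by simpa [add_assoc] using h (i + 3)
      have h2 : ∀ i : Fin 7, i + 4 + 3 = i := by decide
      simp only [x, h2, Bool.and_eq_false_iff, decide_eq_false_iff_not]
      rw [K.adj_comm (g (i + 4))]
      tauto)
  have hsinj : s.Injective := by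
    clear hfav
    fin_cases hs <;> decide
  refine ⟨g ∘ s, hg.comp hsinj, favourable_of_favourableBool (m := sevenMatrix x) ?_ ?_ hfav⟩
  · intro i j hij
    have a0 := h 0
    have a1 := h 1
    have a2 := h 2
    have a3 := h 3
    have a4 := h 4
    have a5 := h 5
    have a6 := (h 6).symm
    have b0 := hn 0
    have b1 := hn 1
    have b2 := hn 2
    have b3 := hn 3
    have b4 := hn 4
    have b5 := fun t : K.Adj (g 0) (g 5) => hn 5 t.symm
    have b6 := fun t : K.Adj (g 1) (g 6) => hn 6 t.symm
    fin_cases i <;> fin_cases j <;> first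
      | (exfalso; revert hij; decide)
      | (simp [sevenMatrix, x]; assumption)
      | (simp [sevenMatrix, x]; exact K.adj_comm _ _)
      | simp [sevenMatrix, x]
  · intro i j hij
    fin_cases i <;> fin_cases j <;> first
      | (exfalso; revert hij; decide)
      | rfl

end Favourable

end SimpleGraph

namespace SimpleGraph

section OddCycle

variable {α : Type*} {K : SimpleGraph α}

/-- A graph that is not bipartite has a cycle of odd length. -/
lemma exists_odd_cycle_of_not_colorable_two (hK : ¬ K.Colorable 2) :
    ∃ (n : ℕ) (f : ℕ → α), Odd n ∧ (∀ i < n, ∀ j < n, f i = f j → i = j) ∧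
      (∀ i < n, K.Adj (f i) (f (i + 1))) ∧ f n = f 0 := by
  classical
  have hex : ∃ n, Odd n ∧ ∃ (u : α) (w : K.Walk u u), w.length = n := by
    rw [two_colorable_iff_forall_loop_even] at hK
    push Not at hK
    obtain ⟨u, w, hw⟩ := hK
    exact ⟨_, Nat.not_even_iff_odd.1 hw, u, w, rfl⟩
  obtain ⟨hodd, u, w, hlen⟩ := Nat.find_spec hex
  have hmin := fun m => Nat.find_min (m := m) hex
  generalize Nat.find hex = n at *
  have hne : ∀ i j, i < j → j < n → w.getVert i ≠ w.getVert j := by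
    intro i j hij hj heq
    have hlong : Even ((w.take i).length + (w.drop j).length) := by
      by_contra hcon
      rw [Nat.not_even_iff_odd] at hcon
      refine hmin _ ?_ ⟨hcon, u, ((w.take i).copy rfl heq).append (w.drop j), by simp⟩
      simp
      omega
    have hshort : Even (((w.drop i).take (j - i)).length) := by
      by_contra hcon
      rw [Nat.not_even_iff_odd] at hcon
      have hend : (w.drop i).getVert (j - i) = w.getVert i := by
        rw [Walk.drop_getVert, heq]
        congr 1
        omega
      refine hmin _ ?_ ⟨hcon, _, ((w.drop i).take (j - i)).copy rfl hend, by simp⟩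
      simp
      omega
    simp only [Walk.take_length, Walk.drop_length, hlen] at hlong hshort
    rw [Nat.min_eq_left (by omega)] at hlong hshort
    grind
  refine ⟨n, w.getVert, hodd, fun i hi j hj h => ?_, fun i hi => ?_, ?_⟩
  · rcases lt_trichotomy i j with hij | hij | hij
    · exact absurd h (hne i j hij hj)
    · exact hij
    · exact absurd h.symm (hne j i hij hi)
  · exact w.adj_getVert_succ (by omega)
  · rw [← hlen, Walk.getVert_length, Walk.getVert_zero]

/-- A triangle-free graph on seven vertices without independent sets of size four has a
favourable labelling. -/
lemma exists_favourable [Fintype α] (hcard : Fintype.card α = 7)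
    (htri : ∀ a b c, K.Adj a b → K.Adj b c → ¬ K.Adj a c)
    (hind : ∀ f : Fin 4 → α, f.Injective → ∃ i j, K.Adj (f i) (f j)) :
    ∃ g : Fin 7 → α, g.Injective ∧ K.Favourable g := by
  classical
  have hK : ¬ K.Colorable 2 := by
    rintro ⟨C⟩
    obtain ⟨k, hk⟩ := Fintype.exists_lt_card_fiber_of_mul_lt_card (f := C) (n := 3)
      (by simp [hcard])
    obtain ⟨t, ht, htc⟩ := Finset.exists_subset_card_eq (n := 4) hk
    obtain ⟨i, j, hij⟩ := hind (fun i => (t.equivFinOfCardEq htc).symm i)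
      (fun i j h => by simpa using h)
    have hcol : ∀ i, C ((t.equivFinOfCardEq htc).symm i) = k := fun i => by
      simpa using ht ((t.equivFinOfCardEq htc).symm i).2
    exact C.valid hij ((hcol i).trans (hcol j).symm)
  obtain ⟨n, f, hodd, hinj, hadj, hclose⟩ := exists_odd_cycle_of_not_colorable_two hK
  have hf : Function.Injective (fun i : Fin n => f i) := fun i j h =>
    Fin.ext (hinj i i.2 j j.2 h)
  have hn7 : n ≤ 7 := by
    simpa [hcard] using Fintype.card_le_of_injective _ hf
  have hcases : n = 1 ∨ n = 3 ∨ n = 5 ∨ n = 7 := by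
    obtain ⟨k, hk⟩ := hodd
    omega
  rcases hcases with rfl | rfl | rfl | rfl
  · exact absurd (hclose ▸ hadj 0 (by simp)) K.irrefl
  · exact absurd (hclose ▸ hadj 2 (by simp)).symm
      (htri _ _ _ (hadj 0 (by simp)) (hadj 1 (by simp)))
  · have hcompl : ((Finset.univ.image fun i : Fin 5 => f i)ᶜ).card = 2 := by
      rw [Finset.card_compl, Finset.card_image_of_injective _ hf, hcard]
      simp
    obtain ⟨x, y, hxy, hset⟩ := Finset.card_eq_two.1 hcompl
    have hx : ∀ i < 5, f i ≠ x := by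
      have : x ∈ (Finset.univ.image fun i : Fin 5 => f i)ᶜ := by simp [hset]
      simp only [Finset.mem_compl, Finset.mem_image, not_exists, Finset.mem_univ, true_and] at this
      exact fun i hi => this ⟨i, hi⟩
    have hy : ∀ i < 5, f i ≠ y := by
      have : y ∈ (Finset.univ.image fun i : Fin 5 => f i)ᶜ := by simp [hset]
      simp only [Finset.mem_compl, Finset.mem_image, not_exists, Finset.mem_univ, true_and] at this
      exact fun i hi => this ⟨i, hi⟩
    refine exists_favourable_of_five (g := ![f 0, f 1, f 2, f 3, f 4, x, y]) htri hind ?_ ?_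
    · intro i j h
      have h5 := fun i hi j hj => mt (hinj i hi j hj)
      fin_cases i <;> fin_cases j <;> first
        | rfl
        | exact absurd h (h5 _ (by simp) _ (by simp) (by simp))
        | exact absurd h (hx _ (by simp))
        | exact absurd h.symm (hx _ (by simp))
        | exact absurd h (hy _ (by simp))
        | exact absurd h.symm (hy _ (by simp))
        | exact absurd h hxy
        | exact absurd h.symm hxy
    · exact ⟨hadj 0 (by simp), hadj 1 (by simp), hadj 2 (by simp), hadj 3 (by simp),
        hclose ▸ hadj 4 (by simp)⟩
  · refine exists_favourable_of_seven htri hf fun i => ?_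
    have := hadj i i.2
    fin_cases i <;> first
      | exact this
      | exact hclose ▸ this

end OddCycle

end SimpleGraph

namespace SimpleGraph

section Connectivity

variable {V : Type*} {G : SimpleGraph V}

/-- The connected component of `p` in the subgraph induced by `S`. -/
lemma exists_connected_subset_closed {S : Set V} {p : V} (hp : p ∈ S) :
    ∃ K ⊆ S, p ∈ K ∧ (G.induce K).Connected ∧ ∀ u ∈ K, ∀ w ∈ S, G.Adj u w → w ∈ K := by
  refine ⟨{w | ∃ q : G.Walk p w, ∀ x ∈ q.support, x ∈ S}, ?_, ?_, ?_, ?_⟩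
  · rintro w ⟨q, hq⟩
    exact hq w q.end_mem_support
  · exact ⟨.nil, by simpa using hp⟩
  · refine G.induce_connected_of_patches p ⟨.nil, by simpa using hp⟩ ?_
    rintro w ⟨q, hq⟩
    classical
    refine ⟨{x | x ∈ q.support}, fun x hx => ⟨q.takeUntil x hx, fun z hz =>
      hq z (q.support_takeUntil_subset_support hx hz)⟩, q.start_mem_support, q.end_mem_support,
      q.connected_induce_support _ _⟩
  · rintro u ⟨q, hq⟩ w hw huw
    refine ⟨q.concat huw, fun x hx => ?_⟩
    rw [Walk.support_concat, List.mem_append, List.mem_singleton] at hx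
    rcases hx with hx | rfl
    exacts [hq x hx, hw]

lemma subset_of_connected_of_closed {K Z : Set V} (hK : (G.induce K).Connected) {q : V}
    (hqK : q ∈ K) (hqZ : q ∈ Z) (h : ∀ u ∈ Z, ∀ w ∈ K, G.Adj u w → w ∈ Z) : K ⊆ Z := by
  intro x hx
  obtain ⟨w⟩ := hK.preconnected ⟨q, hqK⟩ ⟨x, hx⟩
  have key : ∀ a b : K, (G.induce K).Walk a b → (a : V) ∈ Z → (b : V) ∈ Z := by
    intro a b w
    induction w with
    | nil => exact id
    | cons hadj _ ih => exact fun ha => ih (h _ ha _ (Subtype.coe_prop _) hadj)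
  exact key _ _ w hqZ

/-- A connected set that meets `X` and has a point `q` outside `X` contains a connected set
through `q` that is disjoint from `X` but joined to `X` by an edge. -/
lemma exists_connected_diff {K X : Set V} (hK : (G.induce K).Connected) {q x : V}
    (hqK : q ∈ K) (hqX : q ∉ X) (hxK : x ∈ K) (hxX : x ∈ X) :
    ∃ Z ⊆ K \ X, q ∈ Z ∧ (G.induce Z).Connected ∧ ∃ y ∈ X, ∃ z ∈ Z, G.Adj y z := by
  obtain ⟨Z, hZ, hq, hconn, hcl⟩ := exists_connected_subset_closed (G := G) (S := K \ X) ⟨hqK, hqX⟩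
  refine ⟨Z, hZ, hq, hconn, ?_⟩
  by_contra hcon
  push Not at hcon
  exact (hZ (subset_of_connected_of_closed hK hqK hq (fun u hu w hw huw =>
    hcl u hu w ⟨hw, fun hwX => hcon w hwX u hu huw.symm⟩ huw) hxK)).2 hxX

/-- Kempe chains between consecutive members of a sequence of five differently coloured vertices
can be replaced by disjoint connected sets, one around each vertex, that are consecutively joined
by edges. -/
lemma exists_rooted_path {ι : Type*} (c : V → ι) (p : Fin 5 → V)
    (hc : Function.Injective (c ∘ p))
    (hchain : ∀ i j, i ≠ j → ∃ K : Set V, (G.induce K).Connected ∧ p i ∈ K ∧ p j ∈ K ∧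
      ∀ w ∈ K, c w = c (p i) ∨ c w = c (p j)) :
    ∃ B : Fin 5 → Set V, B 0 = {p 0} ∧ (∀ i, p i ∈ B i) ∧ (∀ i, (G.induce (B i)).Connected) ∧
      (∀ i j, i ≠ j → Disjoint (B i) (B j)) ∧ (∀ i, ∀ w ∈ B i, ∃ j, c w = c (p j)) ∧
      (∃ x ∈ B 0, ∃ y ∈ B 1, G.Adj x y) ∧ (∃ x ∈ B 1, ∃ y ∈ B 2, G.Adj x y) ∧
      (∃ x ∈ B 2, ∃ y ∈ B 3, G.Adj x y) ∧ (∃ x ∈ B 3, ∃ y ∈ B 4, G.Adj x y) := by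
  have hcne : ∀ i j, i ≠ j → c (p i) ≠ c (p j) := fun i j hij h => hij (hc h)
  have hne : ∀ i j, i ≠ j → p i ≠ p j := fun i j hij h => hij (hc (congrArg c h))
  obtain ⟨K01, hK01, h010, h011, hc01⟩ := hchain 0 1 (by decide)
  obtain ⟨K12, hK12, h121, h122, hc12⟩ := hchain 1 2 (by decide)
  obtain ⟨K23, hK23, h232, h233, hc23⟩ := hchain 2 3 (by decide)
  obtain ⟨K34, hK34, h343, h344, hc34⟩ := hchain 3 4 (by decide)
  obtain ⟨X, hX, hpX, hXc, eX⟩ := exists_connected_diff hK01 (X := {p 0}) h011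
    (hne 1 0 (by decide)) h010 rfl
  obtain ⟨Y, hY, hpY, hYc, eY⟩ := exists_connected_diff hK34 (X := {p 4}) h343
    (hne 3 4 (by decide)) h344 rfl
  have hXcol : ∀ w ∈ X, c w = c (p 0) ∨ c w = c (p 1) := fun w hw => hc01 w (hX hw).1
  have hYcol : ∀ w ∈ Y, c w = c (p 3) ∨ c w = c (p 4) := fun w hw => hc34 w (hY hw).1
  have n01 := hcne 0 1 (by decide)
  have n02 := hcne 0 2 (by decide)
  have n03 := hcne 0 3 (by decide)
  have n04 := hcne 0 4 (by decide)
  have n12 := hcne 1 2 (by decide)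
  have n13 := hcne 1 3 (by decide)
  have n14 := hcne 1 4 (by decide)
  have n23 := hcne 2 3 (by decide)
  have n24 := hcne 2 4 (by decide)
  have n34 := hcne 3 4 (by decide)
  obtain ⟨Z, hZ, hpZ, hZc, eZ⟩ := exists_connected_diff hK12 (X := X) h122
    (fun h => by grind) h121 hpX
  obtain ⟨W, hW, hpW, hWc, eW⟩ := exists_connected_diff hK23 (X := Y) h232
    (fun h => by grind) h233 hpY
  have hZcol : ∀ w ∈ Z, (c w = c (p 1) ∨ c w = c (p 2)) ∧ w ∉ X :=
    fun w hw => ⟨hc12 w (hZ hw).1, (hZ hw).2⟩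
  have hWcol : ∀ w ∈ W, (c w = c (p 2) ∨ c w = c (p 3)) ∧ w ∉ Y :=
    fun w hw => ⟨hc23 w (hW hw).1, (hW hw).2⟩
  have hX0 : p 0 ∉ X := fun h => (hX h).2 rfl
  have hY4 : p 4 ∉ Y := fun h => (hY h).2 rfl
  have hdis : ∀ i j : Fin 5, i < j →
      Disjoint ((![{p 0}, X, Z ∪ W, Y, {p 4}] : Fin 5 → Set V) i)
        ((![{p 0}, X, Z ∪ W, Y, {p 4}] : Fin 5 → Set V) j) := by
    intro i j hij
    rw [Set.disjoint_left]
    fin_cases i <;> fin_cases j <;> first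
      | (exfalso; revert hij; decide)
      | (intro w hi hj
         simp at hi hj
         grind)
  refine ⟨![{p 0}, X, Z ∪ W, Y, {p 4}], rfl, ?_, ?_, ?_, ?_, ?_, ?_, ?_, ?_⟩
  · intro i
    fin_cases i
    exacts [rfl, hpX, Or.inl hpZ, hpY, rfl]
  · intro i
    fin_cases i
    · simp
    · exact hXc
    · exact induce_union_connected hZc.preconnected hWc.preconnected ⟨p 2, hpZ, hpW⟩
    · exact hYc
    · simp
  · intro i j hij
    rcases lt_or_gt_of_ne hij with h | h
    exacts [hdis i j h, (hdis j i h).symm]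
  · intro i w hw
    fin_cases i <;> simp at hw <;> grind
  · exact eX
  · obtain ⟨x, hx, z, hz, h⟩ := eZ
    exact ⟨x, hx, z, Or.inl hz, h⟩
  · obtain ⟨x, hx, z, hz, h⟩ := eW
    exact ⟨z, Or.inr hz, x, hx, h.symm⟩
  · obtain ⟨x, hx, z, hz, h⟩ := eY
    exact ⟨z, hz, x, hx, h.symm⟩

end Connectivity

end SimpleGraph

namespace ContractionCritical7

variable {V : Type} [Fintype V] {G : SimpleGraph V} {v : V}

/-- In a 7-contraction-critical graph, contracting `v` together with an independent set `S` of
neighbours of `v` gives a 6-colouring of `G - v` in which `S` is monochromatic and its colour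
(recorded at `v`) is not used by the other neighbours of `v`. -/
lemma exists_coloring (hG : ContractionCritical7 G) {S : Set V} (hS : S.Nonempty)
    (hadj : ∀ s ∈ S, G.Adj v s) (hind : ∀ s ∈ S, ∀ t ∈ S, ¬ G.Adj s t) :
    ∃ c : V → Fin 6, (∀ u w, u ≠ v → w ≠ v → G.Adj u w → c u ≠ c w) ∧
      (∀ s ∈ S, c s = c v) ∧ ∀ u, G.Adj v u → u ∉ S → c u ≠ c v := by
  classical
  have hvS : v ∉ S := fun h => G.irrefl (hadj v h)
  let bag : {x : V // x ∉ S} → Set V := fun x => if x.1 = v then insert v S else {x.1}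
  let H : SimpleGraph {x : V // x ∉ S} :=
    SimpleGraph.fromRel fun x y => ∃ u ∈ bag x, ∃ w ∈ bag y, G.Adj u w
  have hbag : ∀ x y, x ≠ y → Disjoint (bag x) (bag y) := by
    rintro ⟨x, hx⟩ ⟨y, hy⟩ hxy
    rw [Set.disjoint_left]
    intro w hwx hwy
    have hxy' : x ≠ y := fun h => hxy (Subtype.ext h)
    simp only [bag] at hwx hwy
    split_ifs at hwx hwy <;> simp at hwx hwy <;> grind
  have hminor : IsMinor H G := by
    refine ⟨bag, ?_, hbag, ?_⟩
    · rintro ⟨x, hx⟩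
      by_cases h : x = v
      · rw [show bag ⟨x, hx⟩ = insert v S from if_pos h]
        refine G.induce_connected_of_patches v (Set.mem_insert _ _) ?_
        rintro w (rfl | hw)
        · exact ⟨{w}, by simp, rfl, rfl, Reachable.refl _⟩
        · exact ⟨{v, w}, Set.insert_subset_insert (by simpa using hw), by simp, by simp,
            (G.induce_pair_connected_of_adj (hadj w hw)).preconnected _ _⟩
      · rw [show bag ⟨x, hx⟩ = {x} from if_neg h]
        simp
    · rintro x y ⟨_, h | ⟨u, hu, w, hw, h⟩⟩
      exacts [h, ⟨w, hw, u, hu, h.symm⟩]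
  have hcard : IsEmpty (H ≃g G) := by
    refine ⟨fun e => ?_⟩
    obtain ⟨s, hs⟩ := hS
    have h1 := Fintype.card_congr e.toEquiv
    have h2 := Fintype.card_subtype_lt (p := fun x => x ∉ S) (x := s) (by simpa using hs)
    omega
  have hlt := hG.2 _ H hminor hcard
  obtain ⟨C⟩ : H.Colorable 6 := by
    rw [← chromaticNumber_le_iff_colorable]
    exact Order.le_of_lt_add_one (by exact_mod_cast hlt)
  have hHadj : ∀ x y : {x : V // x ∉ S}, ∀ u ∈ bag x, ∀ w ∈ bag y, x ≠ y → G.Adj u w →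
      C x ≠ C y := fun x y u hu w hw hxy h => C.valid ⟨hxy, Or.inl ⟨u, hu, w, hw, h⟩⟩
  have hbagv : bag ⟨v, hvS⟩ = insert v S := by simp [bag]
  have hself : ∀ x : {x : V // x ∉ S}, x.1 ∈ bag x := by
    intro x
    simp only [bag]
    split_ifs with h <;> simp [h]
  refine ⟨fun x => if h : x ∈ S then C ⟨v, hvS⟩ else C ⟨x, h⟩, ?_, ?_, ?_⟩
  · intro u w huv hwv huw
    by_cases hu : u ∈ S <;> by_cases hw : w ∈ S <;> simp only [hu, hw, dif_pos, dif_neg,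
      not_false_eq_true]
    · exact absurd huw (hind u hu w hw)
    · exact hHadj _ _ u (by simp [hbagv, hu]) w (hself ⟨w, hw⟩)
        (fun h => hwv (congrArg Subtype.val h).symm) huw
    · exact hHadj _ _ u (hself ⟨u, hu⟩) w (by simp [hbagv, hw])
        (fun h => huv (congrArg Subtype.val h)) huw
    · exact hHadj _ _ u (hself ⟨u, hu⟩) w (hself ⟨w, hw⟩)
        (fun h => huw.ne (congrArg Subtype.val h)) huw
  · intro s hs
    simp [hs, hvS]
  · intro u huv hu
    simp only [hu, hvS, dif_neg, not_false_eq_true]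
    exact hHadj _ _ u (hself ⟨u, hu⟩) v (hself ⟨v, hvS⟩)
        (fun h => huv.ne (congrArg Subtype.val h).symm) huv.symm

/-- All six colours appear around `v` in a 6-colouring of `G - v`. -/
lemma exists_adj_color_eq (hG : ContractionCritical7 G) {c : V → Fin 6}
    (hc : ∀ u w, u ≠ v → w ≠ v → G.Adj u w → c u ≠ c w) (k : Fin 6) :
    ∃ u, G.Adj v u ∧ c u = k := by
  classical
  by_contra! hcon
  have h6 : G.Colorable 6 := by
    refine ⟨SimpleGraph.Coloring.mk (Function.update c v k) fun {x y} hxy => ?_⟩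
    by_cases hx : x = v
    · subst hx
      simpa [Function.update_of_ne hxy.ne'] using (hcon y hxy).symm
    · by_cases hy : y = v
      · subst hy
        simpa [Function.update_of_ne hx] using hcon x hxy.symm
      · simpa [Function.update_of_ne hx, Function.update_of_ne hy] using hc x y hx hy hxy
  have := h6.chromaticNumber_le
  rw [hG.1] at this
  exact absurd this (by decide)

/-- Two neighbours of `v` that are the only ones of their colours are joined by a Kempe chain
of `G - v`. -/
lemma exists_kempe_chain (hG : ContractionCritical7 G) {c : V → Fin 6}
    (hc : ∀ u w, u ≠ v → w ≠ v → G.Adj u w → c u ≠ c w) {p q : V} (hpv : G.Adj v p)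
    (hpq : p ≠ q) (hp : ∀ u, G.Adj v u → c u = c p → u = p)
    (hq : ∀ u, G.Adj v u → c u = c q → u = q) :
    ∃ K : Set V, (G.induce K).Connected ∧ p ∈ K ∧ q ∈ K ∧
      ∀ w ∈ K, c w = c p ∨ c w = c q := by
  classical
  obtain ⟨K, hKS, hpK, hconn, hcl⟩ := exists_connected_subset_closed (G := G)
    (S := {w | w ≠ v ∧ (c w = c p ∨ c w = c q)}) (p := p) ⟨hpv.ne', Or.inl rfl⟩
  refine ⟨K, hconn, hpK, ?_, fun w hw => (hKS hw).2⟩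
  by_contra hqK
  have hpq' : c p ≠ c q := fun h => hpq (hq p hpv h)
  have hc' : ∀ u w, u ≠ v → w ≠ v → G.Adj u w →
      (if u ∈ K then Equiv.swap (c p) (c q) (c u) else c u) ≠
        (if w ∈ K then Equiv.swap (c p) (c q) (c w) else c w) := by
    intro u w hu hw huw
    have h0 := hc u w hu hw huw
    have hmix : ∀ x y, x ≠ v → y ≠ v → G.Adj x y → x ∈ K → y ∉ K →
        Equiv.swap (c p) (c q) (c x) ≠ c y := by
      intro x y hx hy hxy hxK hyK h
      have hy' : ¬ (c y = c p ∨ c y = c q) := fun h => hyK (hcl x hxK y ⟨hy, h⟩ hxy)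
      rcases (hKS hxK).2 with h1 | h1 <;> simp [h1] at h <;> grind
    split_ifs with h1 h2 h2
    · simpa using h0
    · exact hmix u w hu hw huw h1 h2
    · exact (hmix w u hw hu huw.symm h2 h1).symm
    · exact h0
  obtain ⟨u, huv, hu⟩ := hG.exists_adj_color_eq hc' (c p)
  split_ifs at hu with h
  · rw [Equiv.swap_apply_eq_iff, Equiv.swap_apply_left] at hu
    exact hqK (hq u huv hu ▸ h)
  · exact h (hp u huv hu ▸ hpK)

/-- A vertex of degree seven has no three pairwise non-adjacent neighbours. -/
lemma not_independent_of_degree_eq_seven [DecidableRel G.Adj] (hG : ContractionCritical7 G)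
    (hv : G.degree v = 7) {x y z : V} (hx : G.Adj v x) (hy : G.Adj v y) (hz : G.Adj v z)
    (hxy : x ≠ y) (hxz : x ≠ z) (hyz : y ≠ z) (nxy : ¬ G.Adj x y) (nxz : ¬ G.Adj x z) :
    G.Adj y z := by
  classical
  by_contra nyz
  have hS : ∀ s ∈ ({x, y, z} : Set V), G.Adj v s := by
    rintro s (rfl | rfl | rfl) <;> assumption
  obtain ⟨c, hc, hcS, -⟩ := hG.exists_coloring (v := v) (S := {x, y, z}) (by simp) hS (by
    rintro s (rfl | rfl | rfl) t (rfl | rfl | rfl) <;> simp_all [G.adj_comm])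
  have hsub : {x, y, z} ⊆ G.neighborFinset v := by
    intro s hs
    rw [mem_neighborFinset]
    exact hS s (by simpa using hs)
  have huniv : (Finset.univ : Finset (Fin 6)) ⊆
      insert (c v) ((G.neighborFinset v \ {x, y, z}).image c) := by
    intro k _
    obtain ⟨u, hu, rfl⟩ := hG.exists_adj_color_eq hc k
    by_cases h : u ∈ ({x, y, z} : Finset V)
    · exact Finset.mem_insert.2 (Or.inl (hcS u (by simpa using h)))
    · exact Finset.mem_insert_of_mem (Finset.mem_image_of_mem _ (by simp_all))
  have h1 := Finset.card_le_card huniv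
  have h2 := Finset.card_insert_le (c v) ((G.neighborFinset v \ {x, y, z}).image c)
  have h3 := Finset.card_image_le (s := G.neighborFinset v \ {x, y, z}) (f := c)
  rw [Finset.card_sdiff_of_subset hsub, card_neighborFinset_eq_degree, hv,
    Finset.card_eq_three.2 ⟨x, y, z, hxy, hxz, hyz, rfl⟩] at h3
  simp at h1
  omega

end ContractionCritical7

/-- To exhibit a `K7vee`-minor it suffices to find the edges between branch sets in one
direction. -/
lemma isMinor_K7vee_of_lt {V : Type} {G : SimpleGraph V} (bag : Fin 7 → Set V)
    (hconn : ∀ i, (G.induce (bag i)).Connected)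
    (hdisj : ∀ i j, i < j → Disjoint (bag i) (bag j))
    (hadj : ∀ i j, i < j → K7vee.Adj i j → ∃ u ∈ bag i, ∃ w ∈ bag j, G.Adj u w) :
    IsMinor K7vee G := by
  refine ⟨bag, hconn, fun i j hij => ?_, fun i j hij => ?_⟩
  · rcases lt_or_gt_of_ne hij with h | h
    exacts [hdisj i j h, (hdisj j i h).symm]
  · rcases lt_or_gt_of_ne hij.ne with h | h
    · exact hadj i j h hij
    · obtain ⟨u, hu, w, hw, huw⟩ := hadj j i h hij.symm
      exact ⟨w, hw, u, hu, huw.symm⟩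

lemma ContractionCritical7.isMinor_K7vee_of_favourable {V : Type} [Fintype V]
    {G : SimpleGraph V} {v : V} (hG : ContractionCritical7 G) {g : Fin 7 → V}
    (hg : g.Injective) (hgv : ∀ i, G.Adj v (g i)) (hsurj : ∀ u, G.Adj v u → ∃ i, g i = u)
    (hfav : Gᶜ.Favourable g) : IsMinor K7vee G := by
  have hcompl : ∀ i j, i ≠ j → ¬ Gᶜ.Adj (g i) (g j) → G.Adj (g i) (g j) := by
    intro i j hij h
    by_contra h'
    exact h ⟨hg.ne hij, h'⟩
  obtain ⟨n01, a12, a02, a03, a05, a35, a36, a46, a4, a5, a6⟩ := hfav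
  replace a12 := hcompl _ _ (by decide) a12
  replace a02 := hcompl _ _ (by decide) a02
  replace a03 := hcompl _ _ (by decide) a03
  replace a05 := hcompl _ _ (by decide) a05
  replace a35 := hcompl _ _ (by decide) a35
  replace a36 := hcompl _ _ (by decide) a36
  replace a46 := hcompl _ _ (by decide) a46
  replace a4 := a4.imp (hcompl _ _ (by decide)) (hcompl _ _ (by decide))
  replace a5 := a5.imp (hcompl _ _ (by decide)) (hcompl _ _ (by decide))
  replace a6 := a6.imp (hcompl _ _ (by decide)) (hcompl _ _ (by decide))
  obtain ⟨c, hc, hcS, hcN⟩ := hG.exists_coloring (v := v) (S := {g 0, g 1}) (by simp)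
    (by rintro s (rfl | rfl) <;> exact hgv _)
    (by
      have := n01.2
      rintro s (rfl | rfl) t (rfl | rfl) <;> simp_all [G.adj_comm])
  have c0 : c (g 0) = c v := hcS _ (by simp)
  have c1 : c (g 1) = c v := hcS _ (by simp)
  let t : Fin 6 → Fin 7 := ![0, 2, 3, 4, 5, 6]
  have ht : ∀ i : Fin 7, i ≠ 1 → ∃ j, t j = i := by decide
  have hcinj : Function.Injective (fun j => c (g (t j))) := by
    rw [Finite.injective_iff_surjective]
    intro k
    obtain ⟨u, hu, rfl⟩ := hG.exists_adj_color_eq hc k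
    obtain ⟨i, rfl⟩ := hsurj u hu
    by_cases hi : i = 1
    · exact ⟨0, by simp [t, hi, c0, c1]⟩
    · obtain ⟨j, rfl⟩ := ht i hi
      exact ⟨j, rfl⟩
  let p : Fin 5 → V := fun i => g (t i.succ)
  have hcp : Function.Injective (c ∘ p) := fun i j h => Fin.succ_injective _ (hcinj h)
  have hpv : ∀ i, c (p i) ≠ c v := fun i h => by
    have : i.succ = 0 := hcinj (h.trans c0.symm)
    exact Fin.succ_ne_zero i this
  have huniq : ∀ i u, G.Adj v u → c u = c (p i) → u = p i := by
    intro i u hu hcu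
    obtain ⟨k, rfl⟩ := hsurj u hu
    by_cases hk : k = 1
    · subst hk
      exact absurd (hcu.symm.trans c1) (hpv i)
    · obtain ⟨j, rfl⟩ := ht k hk
      rw [hcinj hcu]
  obtain ⟨B, hB0, hpB, hBconn, hBdisj, hBcol, e01, e12, e23, e34⟩ := exists_rooted_path c p hcp
    fun i j hij => hG.exists_kempe_chain hc (hgv _) (fun h => hij (hcp (congrArg c h)))
      (huniq i) (huniq j)
  have hnot : ∀ x, c x = c v → ∀ i, x ∉ B i := by
    intro x hx i hxi
    obtain ⟨j, hj⟩ := hBcol i x hxi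
    exact hpv j (hj.symm.trans hx)
  have h01 : g 0 ≠ g 1 := hg.ne (by decide)
  have h0v : g 0 ≠ v := (hgv 0).ne'
  have h1v : g 1 ≠ v := (hgv 1).ne'
  have m0 := hnot _ c0
  have m1 := hnot _ c1
  have mv := hnot v rfl
  refine isMinor_K7vee_of_lt ![{g 0}, B 2, B 4, {v}, insert (g 1) (B 0), B 1, B 3] ?_ ?_ ?_
  · intro i
    fin_cases i
    · simp
    · exact hBconn 2
    · exact hBconn 4
    · simp
    · change (G.induce (insert (g 1) (B 0))).Connected
      rw [hB0]
      exact induce_pair_connected_of_adj a12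
    · exact hBconn 1
    · exact hBconn 3
  · intro i j hij
    fin_cases i <;> fin_cases j <;> first
      | (exfalso; revert hij; decide)
      | exact hBdisj _ _ (by decide)
      | simp [h01, h0v, h1v.symm, m0, m1, mv, hBdisj]
  · have hv : ∀ i, G.Adj v (p i) := fun i => hgv _
    have hsymm : ∀ {X Y : Set V}, (∃ x ∈ X, ∃ y ∈ Y, G.Adj x y) → ∃ y ∈ Y, ∃ x ∈ X, G.Adj y x :=
      fun ⟨x, hx, y, hy, h⟩ => ⟨y, hy, x, hx, h.symm⟩
    have hmerge : ∀ i, G.Adj (g 2) (p i) ∨ G.Adj (g 1) (p i) →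
        ∃ x ∈ B i, ∃ y ∈ insert (g 1) (B 0), G.Adj x y := by
      rintro i (h | h)
      · exact ⟨p i, hpB i, g 2, Or.inr (hpB 0), h.symm⟩
      · exact ⟨p i, hpB i, g 1, Or.inl rfl, h.symm⟩
    intro i j hij hK
    fin_cases i <;> fin_cases j <;> first
      | (exfalso; revert hij; decide)
      | (exfalso; revert hK; simp [K7vee]; done)
      | skip
    · exact ⟨g 0, rfl, v, rfl, (hgv 0).symm⟩
    · exact ⟨g 0, rfl, p 0, Or.inr (hpB 0), a02⟩
    · exact ⟨g 0, rfl, p 1, hpB 1, a03⟩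
    · exact ⟨g 0, rfl, p 3, hpB 3, a05⟩
    · exact ⟨p 2, hpB 2, p 4, hpB 4, a46⟩
    · exact ⟨p 2, hpB 2, v, rfl, (hv 2).symm⟩
    · exact hmerge 2 a4
    · exact hsymm e12
    · exact e23
    · exact ⟨p 4, hpB 4, v, rfl, (hv 4).symm⟩
    · exact hmerge 4 a6
    · exact ⟨p 4, hpB 4, p 1, hpB 1, a36.symm⟩
    · exact hsymm e34
    · exact ⟨v, rfl, p 0, Or.inr (hpB 0), hv 0⟩
    · exact ⟨v, rfl, p 1, hpB 1, hv 1⟩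
    · exact ⟨v, rfl, p 3, hpB 3, hv 3⟩
    · obtain ⟨x, hx, y, hy, h⟩ := e01
      exact ⟨x, Or.inr hx, y, hy, h⟩
    · exact hsymm (hmerge 3 a5)
    · exact ⟨p 1, hpB 1, p 3, hpB 3, a35⟩

/-- in a 7-contraction-critical graph with no `K7vee`-minor, every vertex
of degree 7 has a 5-clique `L` with `v ∈ L ⊆ N[v]`. -/
theorem statement_17 (V : Type) [Fintype V] (G : SimpleGraph V) [DecidableRel G.Adj]
    (hcrit : ContractionCritical7 G) (hminor : ¬ IsMinor K7vee G)
    (v : V) (hv : G.degree v = 7) :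
    ∃ L : Finset V, G.IsNClique 5 L ∧ v ∈ L ∧
      (L : Set V) ⊆ insert v (G.neighborSet v) := by
  classical
  by_contra hno
  let K : SimpleGraph (G.neighborSet v) := Gᶜ.induce (G.neighborSet v)
  have hKadj : ∀ x y : G.neighborSet v, K.Adj x y ↔ x ≠ y ∧ ¬ G.Adj x y := by
    intro x y
    simp [K, Subtype.coe_inj]
  have hcard : Fintype.card (G.neighborSet v) = 7 := by
    rw [card_neighborSet_eq_degree, hv]
  have htri : ∀ x y z, K.Adj x y → K.Adj y z → ¬ K.Adj x z := by
    intro x y z hxy hyz hxz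
    rw [hKadj] at hxy hyz hxz
    exact hyz.2 (hcrit.not_independent_of_degree_eq_seven hv x.2 y.2 z.2
      (Subtype.coe_injective.ne hxy.1) (Subtype.coe_injective.ne hxz.1)
      (Subtype.coe_injective.ne hyz.1) hxy.2 hxz.2)
  have hind : ∀ f : Fin 4 → G.neighborSet v, f.Injective → ∃ i j, K.Adj (f i) (f j) := by
    intro f hf
    by_contra! hK
    have hadj : ∀ i j, i ≠ j → G.Adj (f i) (f j) := fun i j hij => by
      by_contra h
      exact hK i j ((hKadj _ _).2 ⟨hf.ne hij, h⟩)
    refine hno ⟨insert v (Finset.univ.image fun i => (f i : V)), ⟨?_, ?_⟩, by simp, ?_⟩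
    · rw [Finset.coe_insert, isClique_insert]
      refine ⟨?_, ?_⟩
      · intro x hx y hy hxy
        simp only [Finset.coe_image, Finset.coe_univ, Set.image_univ, Set.mem_range] at hx hy
        obtain ⟨i, rfl⟩ := hx
        obtain ⟨j, rfl⟩ := hy
        exact hadj i j fun h => hxy (h ▸ rfl)
      · intro x hx _
        simp only [Finset.coe_image, Finset.coe_univ, Set.image_univ, Set.mem_range] at hx
        obtain ⟨i, rfl⟩ := hx
        exact (f i).2
    · have hf' : Function.Injective fun i => (f i : V) := Subtype.coe_injective.comp hf
      rw [Finset.card_insert_of_notMem, Finset.card_image_of_injective _ hf']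
      · simp
      · simp only [Finset.mem_image, Finset.mem_univ, true_and, not_exists]
        exact fun i h => G.ne_of_adj (f i).2 h.symm
    · rw [Finset.coe_insert]
      refine Set.insert_subset_insert ?_
      intro x hx
      simp only [Finset.coe_image, Finset.coe_univ, Set.image_univ, Set.mem_range] at hx
      obtain ⟨i, rfl⟩ := hx
      exact (f i).2
  obtain ⟨g', hg', hfav'⟩ := exists_favourable hcard htri hind
  exact hminor (hcrit.isMinor_K7vee_of_favourable (g := fun i => (g' i : V))
    (Subtype.coe_injective.comp hg') (fun i => (g' i).2) (fun u hu => by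
      have hsurj := (Fintype.bijective_iff_injective_and_card g').2 ⟨hg', by simp [hcard]⟩
      obtain ⟨i, hi⟩ := hsurj.2 ⟨u, hu⟩
      exact ⟨i, congrArg Subtype.val hi⟩) (by
      simp only [Favourable, K, comap_adj, Function.Embedding.subtype_apply] at hfav' ⊢
      exact hfav'))
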